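/- arXiv:0910.4511 — 2 statements merged into one kernel-verified Lean document; each statement's English description precedes it below -/
import Mathlib

section
/- For a weakly C(4) finite monoid presentation ⟨A | R⟩: if a word u has no clean overlap prefix, then u contains no relation word as a factor, and consequently u ≡ v implies u = v (equality of words). -/
open List

/-- A *relation word* is a word occurring as one side of some relation in `R`. -/
def RelWord {A : Type*} (R : Finset (List A × List A)) (w : List A) : Prop :=
  ∃ p ∈ R, w = p.1 ∨ w = p.2

/-- One elementary rewriting step using a defining relation (in either direction). -/
def OneStep {A : Type*} (R : Finset (List A × List A)) (u v : List A) : Prop :=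
  ∃ l r x y, ((x, y) ∈ R ∨ (y, x) ∈ R) ∧ u = l ++ x ++ r ∧ v = l ++ y ++ r

/-- `u ≡ v`: the congruence on the free monoid `A*` generated by the relations `R`. -/
def MEquiv {A : Type*} (R : Finset (List A × List A)) : List A → List A → Prop :=
  Relation.ReflTransGen (OneStep R)

/-- A *piece*: a word occurring as a factor of two distinct relation words, or in two
different (possibly overlapping) positions within one relation word.  The empty word
is a piece. -/
def Piece {A : Type*} (R : Finset (List A × List A)) (p : List A) : Prop :=
  p = [] ∨ ∃ r₁ r₂ a₁ b₁ a₂ b₂, RelWord R r₁ ∧ RelWord R r₂ ∧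
    r₁ = a₁ ++ p ++ b₁ ∧ r₂ = a₂ ++ p ++ b₂ ∧ (r₁ ≠ r₂ ∨ a₁ ≠ a₂)

/-- Weakly `C(n)`: no relation word is a product of strictly fewer than `n` pieces. -/
def WeaklyC {A : Type*} (R : Finset (List A × List A)) (n : ℕ) : Prop :=
  ∀ w, RelWord R w → ∀ L : List (List A), (∀ p ∈ L, Piece R p) → w = L.flatten →
    n ≤ L.length

/-- `X` is the maximal (longest) prefix of `r` which is a piece. -/
def MaxPiecePrefix {A : Type*} (R : Finset (List A × List A)) (r X : List A) : Prop :=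
  X <+: r ∧ Piece R X ∧ ∀ p, p <+: r → Piece R p → p.length ≤ X.length

/-- `Z` is the maximal (longest) suffix of `r` which is a piece. -/
def MaxPieceSuffix {A : Type*} (R : Finset (List A × List A)) (r Z : List A) : Prop :=
  Z <:+ r ∧ Piece R Z ∧ ∀ s, s <:+ r → Piece R s → s.length ≤ Z.length

/-- `X ++ Y ++ Z` is a relation word with maximal piece prefix `X`, middle word `Y`
and maximal piece suffix `Z`. -/
def RelDecomp {A : Type*} (R : Finset (List A × List A)) (X Y Z : List A) : Prop :=
  RelWord R (X ++ Y ++ Z) ∧ MaxPiecePrefix R (X ++ Y ++ Z) X ∧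
    MaxPieceSuffix R (X ++ Y ++ Z) Z

/-- `q` is a relation prefix of `u`: a prefix of the form `a ++ X ++ Y` where `X`, `Y`
are the maximal piece prefix and middle word of some relation word `X ++ Y ++ Z`. -/
def RelPrefix {A : Type*} (R : Finset (List A × List A)) (u q : List A) : Prop :=
  q <+: u ∧ ∃ a X Y Z, q = a ++ X ++ Y ∧ RelDecomp R X Y Z

/-- `a ++ X ++ Y` is an overlap prefix of `u`, with final maximal piece prefix `X` and
middle word `Y`, i.e. it admits a factorisation `b X₁ Y₁' ⋯ X_{n-1} Y_{n-1}' X_n Y_n`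
with `X = X_n`, `Y = Y_n`, no factor `X₀ Y₀` beginning strictly before the end of `b`,
each `X_i Y_i Z_i` a relation word factored into maximal piece prefix, middle word and
maximal piece suffix, and each `Y_i'` (`i < n`) a proper non-empty prefix of `Y_i`. -/
def OPrefix {A : Type*} (R : Finset (List A × List A)) (u a X Y : List A) : Prop :=
  (a ++ X ++ Y) <+: u ∧
  ∃ (b : List A) (n : ℕ) (Xs Ys Zs Ys' : ℕ → List A),
    1 ≤ n ∧ Xs (n - 1) = X ∧ Ys (n - 1) = Y ∧
    a = b ++ ((List.range (n - 1)).map fun i => Xs i ++ Ys' i).flatten ∧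
    (∀ i < n, RelDecomp R (Xs i) (Ys i) (Zs i)) ∧
    (∀ i < n - 1, Ys' i ≠ [] ∧ Ys' i <+: Ys i ∧ Ys' i ≠ Ys i) ∧
    ¬ ∃ c d X₀ Y₀ Z₀, RelDecomp R X₀ Y₀ Z₀ ∧
        a ++ X ++ Y = c ++ X₀ ++ Y₀ ++ d ∧ c.length < b.length

/-- The relation prefix `a ++ X ++ Y` of `u` is *clean*: `u` has no prefix
`a ++ X ++ Y₀ ++ X₁ ++ Y₁` with `Y₀` a proper non-empty prefix of `Y` and `X₁`, `Y₁`
the maximal piece prefix and middle word of some relation word. -/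
def CleanAt {A : Type*} (R : Finset (List A × List A)) (u a X Y : List A) : Prop :=
  ¬ ∃ Y₀ X₁ Y₁ Z₁, RelDecomp R X₁ Y₁ Z₁ ∧ Y₀ ≠ [] ∧ Y₀ <+: Y ∧ Y₀ ≠ Y ∧
      (a ++ X ++ Y₀ ++ X₁ ++ Y₁) <+: u

/-- `a ++ X ++ Y` is a clean overlap prefix of `u`, where `X ++ Y ++ Z` is a relation
word with maximal piece prefix `X`, middle word `Y` and maximal piece suffix `Z`. -/
def CleanOverlapPrefix {A : Type*} (R : Finset (List A × List A))
    (u a X Y Z : List A) : Prop :=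
  RelDecomp R X Y Z ∧ OPrefix R u a X Y ∧ CleanAt R u a X Y

/-- `r'` is a complement of the relation word `r`: there is a chain of relation words
from `r` to `r'` each consecutive pair of which forms a relation (in some order). -/
def RelComplement {A : Type*} (R : Finset (List A × List A)) (r r' : List A) : Prop :=
  RelWord R r ∧ Relation.ReflTransGen (fun s t => (s, t) ∈ R ∨ (t, s) ∈ R) r r'

/-- `u` is `p`-active: `p ++ u` has a relation prefix `a ++ X ++ Y` with `|a| < |p|`. -/
def PActive {A : Type*} (R : Finset (List A × List A)) (p u : List A) : Prop :=
  ∃ a X Y Z, RelDecomp R X Y Z ∧ (a ++ X ++ Y) <+: (p ++ u) ∧ a.length < p.length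

/-- `p` is a possible prefix of `u`: `p ++ w ≡ u` for some word `w`. -/
def PossPrefix {A : Type*} (R : Finset (List A × List A)) (p u : List A) : Prop :=
  ∃ w, MEquiv R (p ++ w) u

theorem Piece.of_suffix {A : Type*} {R : Finset (List A × List A)} {p q : List A}
    (hp : Piece R p) (hq : q <:+ p) : Piece R q := by
  obtain ⟨c, rfl⟩ := hq
  rcases hp with hp | ⟨r₁, r₂, a₁, b₁, a₂, b₂, h₁, h₂, e₁, e₂, hne⟩
  · exact Or.inl (List.append_eq_nil_iff.1 hp).2
  · refine Or.inr ⟨r₁, r₂, a₁ ++ c, b₁, a₂ ++ c, b₂, h₁, h₂, by simp [e₁], by simp [e₂], ?_⟩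
    simpa using hne

theorem exists_maxPiecePrefix {A : Type*} (R : Finset (List A × List A)) (r : List A) :
    ∃ m ≤ r.length, MaxPiecePrefix R r (r.take m) := by
  classical
  have hle := Nat.findGreatest_le (P := fun n => Piece R (r.take n)) r.length
  refine ⟨_, hle, List.take_prefix _ _,
    Nat.findGreatest_spec (P := fun n => Piece R (r.take n)) (Nat.zero_le r.length)
      (Or.inl (by simp)), fun p hp hpp => ?_⟩
  rw [List.length_take_of_le hle]
  refine Nat.le_findGreatest hp.length_le ?_
  rwa [← List.prefix_iff_eq_take.1 hp]

theorem exists_maxPieceSuffix {A : Type*} (R : Finset (List A × List A)) (r : List A) :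
    ∃ k ≤ r.length, MaxPieceSuffix R r (r.drop k) := by
  classical
  have hex : ∃ k, Piece R (r.drop k) := ⟨r.length, Or.inl (by simp)⟩
  refine ⟨Nat.find hex, Nat.find_min' hex (Or.inl (by simp)), List.drop_suffix _ _,
    Nat.find_spec hex, fun p hp hpp => ?_⟩
  have hle := hp.length_le
  have hfind : Nat.find hex ≤ r.length - p.length :=
    Nat.find_min' hex (by rwa [← List.suffix_iff_eq_drop.1 hp])
  rw [List.length_drop]
  omega

/-- In a weakly `C(3)` presentation every relation word factors into its maximal piece prefix,
middle word and maximal piece suffix. -/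
theorem RelWord.exists_relDecomp {A : Type*} {R : Finset (List A × List A)} (hC : WeaklyC R 3)
    {r : List A} (hr : RelWord R r) : ∃ X Y Z, r = X ++ Y ++ Z ∧ RelDecomp R X Y Z := by
  obtain ⟨m, -, hm⟩ := exists_maxPiecePrefix R r
  obtain ⟨k, -, hk⟩ := exists_maxPieceSuffix R r
  rcases lt_or_ge k m with hkm | hmk
  · have hlen := hC r hr [r.take m, r.drop m] (by
      simpa using ⟨hm.2.1, hk.2.1.of_suffix (List.drop_suffix_drop_left r hkm.le)⟩) (by simp)
    simp at hlen
  · have hX : r.take m ++ (r.take k).drop m = r.take k := by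
      conv_rhs => rw [← List.take_append_drop m (r.take k), List.take_take, min_eq_left hmk]
    have hr' : r.take m ++ (r.take k).drop m ++ r.drop k = r := by
      rw [hX, List.take_append_drop]
    exact ⟨r.take m, (r.take k).drop m, r.drop k, hr'.symm, by
      rw [RelDecomp, hr']
      exact ⟨hr, hm, hk⟩⟩

/-- The words `a = b X₁ Y₁' ⋯ X_{n-1} Y_{n-1}'`, `X = X_n` and `Y = Y_n` come from a sequence of
overlapping relation words starting at the end of `b`. -/
inductive OverlapChain {A : Type*} (R : Finset (List A × List A)) (b : List A) :
    List A → List A → List A → Prop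
  | base {X Y Z : List A} (h : RelDecomp R X Y Z) : OverlapChain R b b X Y
  | step {a X Y Y' X₁ Y₁ Z₁ : List A} (h : OverlapChain R b a X Y) (hne : Y' ≠ [])
      (hpre : Y' <+: Y) (hproper : Y' ≠ Y) (h₁ : RelDecomp R X₁ Y₁ Z₁) :
      OverlapChain R b (a ++ X ++ Y') X₁ Y₁

theorem OverlapChain.exists_relDecomp {A : Type*} {R : Finset (List A × List A)}
    {b a X Y : List A} (h : OverlapChain R b a X Y) : ∃ Z, RelDecomp R X Y Z := by
  cases h with
  | base h => exact ⟨_, h⟩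
  | step _ _ _ _ h => exact ⟨_, h⟩

theorem OverlapChain.exists_factorisation {A : Type*} {R : Finset (List A × List A)}
    {b a X Y : List A} (h : OverlapChain R b a X Y) :
    ∃ (m : ℕ) (Xs Ys Zs Ys' : ℕ → List A), Xs m = X ∧ Ys m = Y ∧
      a = b ++ ((List.range m).map fun i => Xs i ++ Ys' i).flatten ∧
      (∀ i < m + 1, RelDecomp R (Xs i) (Ys i) (Zs i)) ∧
      (∀ i < m, Ys' i ≠ [] ∧ Ys' i <+: Ys i ∧ Ys' i ≠ Ys i) := by
  induction h with
  | @base X Y Z h =>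
    exact ⟨0, fun _ => X, fun _ => Y, fun _ => Z, fun _ => [], rfl, rfl, by simp,
      fun _ _ => h, by simp⟩
  | @step a X Y Y' X₁ Y₁ Z₁ _ hne hpre hproper h₁ ih =>
    obtain ⟨m, Xs, Ys, Zs, Ys', rfl, rfl, rfl, hdec, hY⟩ := ih
    refine ⟨m + 1, fun i => if i ≤ m then Xs i else X₁, fun i => if i ≤ m then Ys i else Y₁,
      fun i => if i ≤ m then Zs i else Z₁, fun i => if i < m then Ys' i else Y',
      by simp, by simp, ?_, fun i hi => ?_, fun i hi => ?_⟩
    · have hmap : ((List.range m).map fun i =>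
          (if i ≤ m then Xs i else X₁) ++ (if i < m then Ys' i else Y')) =
          (List.range m).map fun i => Xs i ++ Ys' i := by
        refine List.map_congr_left fun i hi => ?_
        have hlt := List.mem_range.1 hi
        simp [hlt, hlt.le]
      rw [List.range_succ, List.map_append, List.flatten_append, hmap]
      simp
    · by_cases him : i ≤ m
      · simpa [him] using hdec i (by omega)
      · simpa [him] using h₁
    · rcases Nat.lt_succ_iff_lt_or_eq.1 hi with hlt | rfl
      · simpa [hlt, hlt.le] using hY i hlt
      · simpa using ⟨hne, hpre, hproper⟩

/-- A chain starting at the leftmost occurrence in `u` of some `X₀ Y₀` is an overlap prefix. -/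
theorem OverlapChain.oPrefix {A : Type*} {R : Finset (List A × List A)} {u b a X Y : List A}
    (h : OverlapChain R b a X Y) (hu : (a ++ X ++ Y) <+: u)
    (hb : ∀ c X₀ Y₀ Z₀, RelDecomp R X₀ Y₀ Z₀ → (c ++ X₀ ++ Y₀) <+: u → b.length ≤ c.length) :
    OPrefix R u a X Y := by
  obtain ⟨m, Xs, Ys, Zs, Ys', hX, hY, ha, hdec, hYs⟩ := h.exists_factorisation
  refine ⟨hu, b, m + 1, Xs, Ys, Zs, Ys', by omega, hX, hY, ha, hdec, hYs, ?_⟩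
  rintro ⟨c, d, X₀, Y₀, Z₀, h₀, heq, hlt⟩
  refine absurd (hb c X₀ Y₀ Z₀ h₀ ?_) (by omega)
  exact List.IsPrefix.trans ⟨d, heq.symm⟩ hu

theorem OverlapChain.exists_cleanOverlapPrefix {A : Type*} {R : Finset (List A × List A)}
    {u b a X Y : List A} (h : OverlapChain R b a X Y) (hu : (a ++ X ++ Y) <+: u)
    (hb : ∀ c X₀ Y₀ Z₀, RelDecomp R X₀ Y₀ Z₀ → (c ++ X₀ ++ Y₀) <+: u → b.length ≤ c.length) :
    ∃ a X Y Z, CleanOverlapPrefix R u a X Y Z := by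
  by_cases hclean : CleanAt R u a X Y
  · obtain ⟨Z, hZ⟩ := h.exists_relDecomp
    exact ⟨a, X, Y, Z, hZ, h.oPrefix hu hb, hclean⟩
  · obtain ⟨Y', X₁, Y₁, Z₁, h₁, hne, hpre, hproper, hu₁⟩ := not_not.1 hclean
    have hpos := List.length_pos_of_ne_nil hne
    have hle := hu₁.length_le
    exact (h.step hne hpre hproper h₁).exists_cleanOverlapPrefix hu₁ hb
termination_by u.length - a.length
decreasing_by
  simp only [List.length_append] at hle ⊢
  omega

/-- A word containing the maximal piece prefix and middle word of some relation word has a clean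
overlap prefix. -/
theorem RelDecomp.exists_cleanOverlapPrefix {A : Type*} {R : Finset (List A × List A)}
    {u a X Y Z : List A} (h : RelDecomp R X Y Z) (hu : (a ++ X ++ Y) <+: u) :
    ∃ a X Y Z, CleanOverlapPrefix R u a X Y Z := by
  classical
  have hex : ∃ n, ∃ b X Y Z, RelDecomp R X Y Z ∧ (b ++ X ++ Y) <+: u ∧ b.length = n :=
    ⟨_, a, X, Y, Z, h, hu, rfl⟩
  obtain ⟨b, X₁, Y₁, Z₁, h₁, hu₁, hlen⟩ := Nat.find_spec hex
  refine (OverlapChain.base (b := b) h₁).exists_cleanOverlapPrefix hu₁ fun c X₀ Y₀ Z₀ h₀ hu₀ => ?_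
  rw [hlen]
  exact Nat.find_min' hex ⟨c, X₀, Y₀, Z₀, h₀, hu₀, rfl⟩

theorem eq_of_mEquiv_of_no_relWord_factor {A : Type*} {R : Finset (List A × List A)}
    {u v : List A} (hu : ¬ ∃ s r t, RelWord R r ∧ u = s ++ r ++ t) (huv : MEquiv R u v) :
    u = v := by
  rcases huv.cases_head with rfl | ⟨w, ⟨l, r, x, y, hxy, rfl, -⟩, -⟩
  · rfl
  · refine absurd ⟨l, x, r, ?_, rfl⟩ hu
    rcases hxy with hxy | hxy
    · exact ⟨_, hxy, Or.inl rfl⟩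
    · exact ⟨_, hxy, Or.inr rfl⟩

/-- Corollary 3: for a weakly `C(4)` finite monoid presentation, if a
word `u` has no clean overlap prefix, then `u` contains no relation word as a factor,
and consequently `u ≡ v` implies `u = v`. -/
theorem no_cleanOverlapPrefix_no_relWord_factor {A : Type*} [Fintype A] [DecidableEq A]
    (R : Finset (List A × List A)) (hC : WeaklyC R 4) (u : List A)
    (h : ¬ ∃ a X Y Z, CleanOverlapPrefix R u a X Y Z) :
    (¬ ∃ s r t, RelWord R r ∧ u = s ++ r ++ t) ∧ (∀ v, MEquiv R u v → u = v) := by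
  have hfactor : ¬ ∃ s r t, RelWord R r ∧ u = s ++ r ++ t := by
    rintro ⟨s, r, t, hr, rfl⟩
    have hC₃ : WeaklyC R 3 := fun w hw L hL hwL => (by omega : 3 ≤ 4).trans (hC w hw L hL hwL)
    obtain ⟨X, Y, Z, rfl, hdec⟩ := hr.exists_relDecomp hC₃
    exact h (hdec.exists_cleanOverlapPrefix (a := s) ⟨Z ++ t, by simp⟩)
  exact ⟨hfactor, fun v => eq_of_mEquiv_of_no_relWord_factor hfactor⟩
end

section
/- For a weakly C(4) finite monoid presentation ⟨A | R⟩: let p₁ and p₂ be pieces and suppose a word u is both p₁-active and p₂-active. Then p₁ and p₂ have a common nonempty suffix, and if z is their maximal common suffix then: (i) u is z-active; (ii) p₁·u ≡ v if and only if v = z₁·v′ where z₁·z = p₁ and v′ ≡ z·u; and (iii) p₂·u ≡ v if and only if v = z₂·v′ where z₂·z = p₂ and v′ ≡ z·u. -/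
open List

theorem Piece.of_append {A : Type*} {R : Finset (List A × List A)} {a p b : List A}
    (h : Piece R (a ++ p ++ b)) : Piece R p := by
  rcases h with h | ⟨r₁, r₂, a₁, b₁, a₂, b₂, h₁, h₂, e₁, e₂, hne⟩
  · left
    simp_all
  · refine Or.inr ⟨r₁, r₂, a₁ ++ a, b ++ b₁, a₂ ++ a, b ++ b₂, h₁, h₂, ?_, ?_, ?_⟩
    · simp [e₁]
    · simp [e₂]
    · simpa using hne

theorem piece_of_occurrences {A : Type*} {R : Finset (List A × List A)}
    {p a₁ b₁ a₂ b₂ : List A} (h₁ : RelWord R (a₁ ++ p ++ b₁))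
    (h₂ : RelWord R (a₂ ++ p ++ b₂)) (hne : a₁ ≠ a₂) : Piece R p :=
  Or.inr ⟨_, _, a₁, b₁, a₂, b₂, h₁, h₂, rfl, rfl, Or.inr hne⟩

theorem WeaklyC.three_pieces {A : Type*} {R : Finset (List A × List A)} (hC : WeaklyC R 4)
    {f g h : List A} (hf : Piece R f) (hg : Piece R g) (hh : Piece R h) :
    ¬ RelWord R (f ++ g ++ h) := by
  intro hw
  have := hC _ hw [f, g, h] (by simp [hf, hg, hh]) (by simp)
  simp at this

theorem WeaklyC.two_pieces {A : Type*} {R : Finset (List A × List A)} (hC : WeaklyC R 4)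
    {f g : List A} (hf : Piece R f) (hg : Piece R g) : ¬ RelWord R (f ++ g) := by
  simpa using hC.three_pieces hf hg (Or.inl rfl : Piece R [])

theorem WeaklyC.not_piece {A : Type*} {R : Finset (List A × List A)} (hC : WeaklyC R 4)
    {f : List A} (hf : RelWord R f) : ¬ Piece R f := fun h =>
  hC.two_pieces h (Or.inl rfl : Piece R []) (by simpa using hf)

theorem relWord_left {A : Type*} {R : Finset (List A × List A)} {x y : List A}
    (h : (x, y) ∈ R ∨ (y, x) ∈ R) : RelWord R x := by
  rcases h with h | h
  · exact ⟨_, h, Or.inl rfl⟩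
  · exact ⟨_, h, Or.inr rfl⟩

theorem MEquiv.symm {A : Type*} {R : Finset (List A × List A)} {u v : List A}
    (h : MEquiv R u v) : MEquiv R v u :=
  have : Std.Symm (OneStep R) :=
    ⟨fun _ _ ⟨l, r, x, y, hxy, e₁, e₂⟩ => ⟨l, r, y, x, hxy.symm, e₂, e₁⟩⟩
  Relation.ReflTransGen.stdSymm.symm _ _ h

theorem MEquiv.append_left {A : Type*} {R : Finset (List A × List A)} {u v : List A}
    (c : List A) (h : MEquiv R u v) : MEquiv R (c ++ u) (c ++ v) :=
  Relation.ReflTransGen.lift (c ++ ·)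
    (fun _ _ ⟨l, r, x, y, hxy, e₁, e₂⟩ => ⟨c ++ l, r, x, y, hxy, by simp [e₁], by simp [e₂]⟩)
    u v h

/-- Words which begin with a chain of non-piece prefixes of relation words, the last of which
is not even a product of two pieces. -/
inductive OverlapChain_s8 {A : Type*} (R : Finset (List A × List A)) : List A → Prop
  | last (m z t : List A) (hm : RelWord R (m ++ z))
      (h : ∀ f g, Piece R f → Piece R g → m ≠ f ++ g) : OverlapChain_s8 R (m ++ t)
  | cons (m z s : List A) (hm : RelWord R (m ++ z)) (h : ¬ Piece R m)
      (hs : OverlapChain_s8 R s) : OverlapChain_s8 R (m ++ s)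

theorem OverlapChain_s8.exists_head {A : Type*} {R : Finset (List A × List A)} {s : List A}
    (h : OverlapChain_s8 R s) : ∃ m z t, s = m ++ t ∧ RelWord R (m ++ z) ∧ ¬ Piece R m := by
  cases h with
  | last m z t hm h => exact ⟨m, z, t, rfl, hm, fun hp => h m [] hp (Or.inl rfl) (by simp)⟩
  | cons m z s hm h hs => exact ⟨m, z, s, rfl, hm, h⟩

theorem OverlapChain_s8.of_relWord {A : Type*} {R : Finset (List A × List A)} (hC : WeaklyC R 4)
    {y : List A} (hy : RelWord R y) (r : List A) : OverlapChain_s8 R (y ++ r) :=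
  .last y [] r (by simpa using hy) fun _ _ hf hg e => hC.two_pieces hf hg (e ▸ hy)

/-- A relation word beginning strictly inside `c` in `c ++ s` meets `s` in a piece at most. -/
theorem OverlapChain_s8.exists_split {A : Type*} {R : Finset (List A × List A)} {s c l x r : List A}
    (hs : OverlapChain_s8 R s) (hx : RelWord R x) (e : c ++ s = l ++ x ++ r)
    (hl : l.length < c.length) : ∃ f g d, c = l ++ f ++ d ∧ x = f ++ g ∧ Piece R g := by
  obtain ⟨m, z, t, rfl, hm, hmp⟩ := hs.exists_head
  obtain ⟨k, rfl, hk⟩ : ∃ k, c = l ++ k ∧ k ++ (m ++ t) = x ++ r := by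
    rw [List.append_assoc] at e
    rcases List.append_eq_append_iff.1 e with ⟨k, rfl, -⟩ | ⟨k, rfl, h⟩
    · simp at hl
    · exact ⟨k, rfl, h.symm⟩
  have hk0 : k ≠ [] := by
    rintro rfl
    simp at hl
  rcases List.append_eq_append_iff.1 hk with ⟨g, rfl, hg⟩ | ⟨d, rfl, -⟩
  · refine ⟨k, g, [], by simp, rfl, ?_⟩
    rcases List.append_eq_append_iff.1 hg with ⟨g', rfl, -⟩ | ⟨d, rfl, -⟩
    · exact absurd (piece_of_occurrences (p := m) (a₁ := k) (b₁ := g') (a₂ := []) (b₂ := z)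
        (by simpa using hx) (by simpa using hm) hk0) hmp
    · exact piece_of_occurrences (p := g) (a₁ := k) (b₁ := []) (a₂ := []) (b₂ := d ++ z)
        (by simpa using hx) (by simpa using hm) hk0
  · exact ⟨x, [], d, by simp, by simp, Or.inl rfl⟩

theorem OverlapChain_s8.oneStep {A : Type*} {R : Finset (List A × List A)} (hC : WeaklyC R 4)
    {s s' : List A} (hs : OverlapChain_s8 R s) (h : OneStep R s s') : OverlapChain_s8 R s' := by
  induction hs generalizing s' with
  | last m z t hm hmp =>
    obtain ⟨l, r, x, y, hxy, e, rfl⟩ := h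
    have hx := relWord_left hxy
    have hy := relWord_left hxy.symm
    rw [List.append_assoc] at e
    rcases List.append_eq_append_iff.1 e with ⟨k, rfl, -⟩ | ⟨k, rfl, hk⟩
    · simpa using OverlapChain_s8.last m z (k ++ y ++ r) hm hmp
    · rcases eq_or_ne l [] with rfl | hl
      · simpa using OverlapChain_s8.of_relWord hC hy r
      · rcases List.append_eq_append_iff.1 hk with ⟨d, rfl, -⟩ | ⟨d, rfl, -⟩
        · exact absurd (piece_of_occurrences (p := x) (a₁ := l) (b₁ := d ++ z) (a₂ := [])
            (b₂ := []) (by simpa using hm) (by simpa using hx) hl) (hC.not_piece hx)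
        · have hkp : Piece R k :=
            piece_of_occurrences (a₁ := l) (b₁ := z) (a₂ := []) (b₂ := d) hm (by simpa using hx) hl
          rw [List.append_assoc]
          exact .cons l (k ++ z) _ (by simpa using hm) (fun hp => hmp l k hp hkp rfl)
            (.of_relWord hC hy r)
  | cons m z s hm hmp hs ih =>
    obtain ⟨l, r, x, y, hxy, e, rfl⟩ := h
    have hx := relWord_left hxy
    rcases lt_or_ge l.length m.length with hlt | hge
    · rcases eq_or_ne l [] with rfl | hl
      · simpa using OverlapChain_s8.of_relWord hC (relWord_left hxy.symm) r
      · obtain ⟨f, g, d, rfl, rfl, hg⟩ := hs.exists_split hx e hlt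
        have hf : Piece R f :=
          piece_of_occurrences (a₁ := l) (b₁ := d ++ z) (a₂ := []) (b₂ := g)
            (by simpa using hm) (by simpa using hx) hl
        exact absurd hx (hC.two_pieces hf hg)
    · rw [List.append_assoc] at e
      obtain ⟨k, rfl⟩ : m <+: l :=
        List.prefix_of_prefix_length_le ⟨s, rfl⟩ ⟨x ++ r, e.symm⟩ hge
      simp only [List.append_assoc, List.append_cancel_left_eq] at e ⊢
      exact .cons m z _ hm hmp (ih ⟨k, r, x, y, hxy, by simpa using e, by simp⟩)

theorem OverlapChain_s8.mequiv_append {A : Type*} {R : Finset (List A × List A)} (hC : WeaklyC R 4)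
    {a s v : List A} (hs : OverlapChain_s8 R s) (ha : Piece R a) (h : MEquiv R (a ++ s) v) :
    ∃ v', v = a ++ v' ∧ MEquiv R s v' ∧ OverlapChain_s8 R v' := by
  induction h with
  | refl => exact ⟨s, rfl, .refl, hs⟩
  | tail _ hstep ih =>
    obtain ⟨w, rfl, hsw, hw⟩ := ih
    obtain ⟨l, r, x, y, hxy, e, rfl⟩ := hstep
    have hx := relWord_left hxy
    rcases lt_or_ge l.length a.length with hlt | hge
    · obtain ⟨f, g, d, rfl, rfl, hg⟩ := hw.exists_split hx e hlt
      exact absurd hx (hC.two_pieces ha.of_append hg)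
    · rw [List.append_assoc] at e
      obtain ⟨k, rfl⟩ : a <+: l :=
        List.prefix_of_prefix_length_le ⟨w, rfl⟩ ⟨x ++ r, e.symm⟩ hge
      have hstep : OneStep R w (k ++ y ++ r) := ⟨k, r, x, y, hxy, by simpa using e, rfl⟩
      exact ⟨k ++ y ++ r, by simp, hsw.tail hstep, hw.oneStep hC hstep⟩

/-- If `u` is `p`-active for a piece `p`, the relation prefix of `p ++ u` witnessing this extends
beyond `p`, and its part inside `u` is not a piece. -/
theorem PActive.exists_overlap {A : Type*} {R : Finset (List A × List A)} (hC : WeaklyC R 4)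
    {p u : List A} (hp : Piece R p) (h : PActive R p u) :
    ∃ a q k t X Y Z, p = a ++ q ∧ q ≠ [] ∧ RelDecomp R X Y Z ∧ X ++ Y = q ++ k ∧ u = k ++ t ∧
      ¬ Piece R k := by
  obtain ⟨a, X, Y, Z, hd, ⟨t, e⟩, hlt⟩ := h
  obtain ⟨q, rfl⟩ : a <+: p :=
    List.prefix_of_prefix_length_le ⟨X ++ Y ++ t, by simpa using e⟩ ⟨u, rfl⟩ hlt.le
  have hq0 : q ≠ [] := by
    rintro rfl
    simp at hlt
  have hq : Piece R q := Piece.of_append (b := []) (by simpa using hp)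
  have e' : X ++ Y ++ t = q ++ u := by simpa using e
  rcases List.append_eq_append_iff.1 e' with ⟨k, rfl, -⟩ | ⟨k, hk, hu⟩
  · exact absurd hd.1 (hC.two_pieces (Piece.of_append (a := []) hq) hd.2.2.2.1)
  · exact ⟨a, q, k, t, X, Y, Z, rfl, hq0, hd, hk, hu, fun hkp =>
      hC.three_pieces hq hkp hd.2.2.2.1 (hk ▸ hd.1)⟩

theorem RelDecomp.eq_of_prefix {A : Type*} {R : Finset (List A × List A)}
    {X₁ Y₁ Z₁ X₂ Y₂ Z₂ q₁ q₂ k₁ k₂ : List A} (h₁ : RelDecomp R X₁ Y₁ Z₁)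
    (h₂ : RelDecomp R X₂ Y₂ Z₂) (e₁ : X₁ ++ Y₁ = q₁ ++ k₁) (e₂ : X₂ ++ Y₂ = q₂ ++ k₂)
    (hk : k₁ <+: k₂) (hk₁ : ¬ Piece R k₁) : q₁ = q₂ := by
  obtain ⟨d, rfl⟩ := hk
  by_contra hne
  exact hk₁ (piece_of_occurrences (b₁ := Z₁) (b₂ := d ++ Z₂) (e₁ ▸ h₁.1)
    (by simpa [e₂] using h₂.1) hne)

theorem RelDecomp.overlapChain {A : Type*} {R : Finset (List A × List A)} (hC : WeaklyC R 4)
    {X Y Z : List A} (h : RelDecomp R X Y Z) (t : List A) : OverlapChain_s8 R (X ++ Y ++ t) :=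
  .last _ Z t h.1 fun _ _ hf hg e => hC.three_pieces hf hg h.2.2.2.1 (e ▸ h.1)

theorem OverlapChain_s8.mequiv_iff {A : Type*} {R : Finset (List A × List A)} (hC : WeaklyC R 4)
    {p q z u : List A} (hp : Piece R p) (hq : OverlapChain_s8 R (q ++ u)) (hqz : q <:+ z)
    (hz : z <:+ p) (v : List A) :
    MEquiv R (p ++ u) v ↔ ∃ z₁ v', v = z₁ ++ v' ∧ z₁ ++ z = p ∧ MEquiv R v' (z ++ u) := by
  constructor
  · intro h
    obtain ⟨b, rfl⟩ := hqz
    obtain ⟨c, rfl⟩ := hz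
    have hcb : Piece R (c ++ b) := Piece.of_append (a := []) (b := q) (by simpa using hp)
    obtain ⟨w, rfl, hw, -⟩ := hq.mequiv_append hC hcb (by simpa using h)
    exact ⟨c, b ++ w, by simp, rfl, by simpa using (hw.append_left b).symm⟩
  · rintro ⟨c, w, rfl, rfl, hw⟩
    simpa using hw.symm.append_left c

/-- Proposition 9: for a weakly `C(4)` finite monoid presentation,
let `p₁`, `p₂` be pieces and `u` a word which is both `p₁`-active and `p₂`-active.
Then `p₁` and `p₂` have a common non-empty suffix, and if `z` is their maximal common
suffix then (i) `u` is `z`-active; (ii) `p₁ ++ u ≡ v` iff `v = z₁ ++ v'` where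
`z₁ ++ z = p₁` and `v' ≡ z ++ u`; and (iii) `p₂ ++ u ≡ v` iff `v = z₂ ++ v'` where
`z₂ ++ z = p₂` and `v' ≡ z ++ u`. -/
theorem coactive {A : Type*} [Fintype A] [DecidableEq A]
    (R : Finset (List A × List A)) (hC : WeaklyC R 4)
    (p₁ p₂ u : List A) (hp₁ : Piece R p₁) (hp₂ : Piece R p₂)
    (h₁ : PActive R p₁ u) (h₂ : PActive R p₂ u) :
    (∃ z, z ≠ [] ∧ z <:+ p₁ ∧ z <:+ p₂) ∧
    ∀ z, z <:+ p₁ → z <:+ p₂ →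
      (∀ z', z' <:+ p₁ → z' <:+ p₂ → z'.length ≤ z.length) →
      PActive R z u ∧
      (∀ v, MEquiv R (p₁ ++ u) v ↔
        ∃ z₁ v', v = z₁ ++ v' ∧ z₁ ++ z = p₁ ∧ MEquiv R v' (z ++ u)) ∧
      (∀ v, MEquiv R (p₂ ++ u) v ↔
        ∃ z₂ v', v = z₂ ++ v' ∧ z₂ ++ z = p₂ ∧ MEquiv R v' (z ++ u)) := by
  obtain ⟨a₁, q, k₁, t₁, X, Y, Z, rfl, hq, hd, e₁, rfl, hk₁⟩ := h₁.exists_overlap hC hp₁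
  obtain ⟨a₂, q₂, k₂, t₂, X₂, Y₂, Z₂, rfl, -, hd₂, e₂, hu, hk₂⟩ := h₂.exists_overlap hC hp₂
  obtain rfl : q = q₂ := by
    rcases List.prefix_or_prefix_of_prefix ⟨t₁, rfl⟩ ⟨t₂, hu.symm⟩ with h | h
    · exact hd.eq_of_prefix hd₂ e₁ e₂ h hk₁
    · exact (hd₂.eq_of_prefix hd e₂ e₁ h hk₂).symm
  refine ⟨⟨q, hq, ⟨a₁, rfl⟩, ⟨a₂, rfl⟩⟩, fun z hz₁ hz₂ hmax => ?_⟩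
  have hqz : q <:+ z :=
    List.suffix_of_suffix_length_le ⟨a₁, rfl⟩ hz₁ (hmax q ⟨a₁, rfl⟩ ⟨a₂, rfl⟩)
  have hchain : OverlapChain_s8 R (q ++ (k₁ ++ t₁)) := by
    simpa [e₁] using hd.overlapChain hC t₁
  refine ⟨?_, hchain.mequiv_iff hC hp₁ hqz hz₁, hchain.mequiv_iff hC hp₂ hqz hz₂⟩
  obtain ⟨b, rfl⟩ := hqz
  refine ⟨b, X, Y, Z, hd, ⟨t₁, ?_⟩, ?_⟩
  · simp [List.append_assoc b, e₁]
  · simpa [List.length_pos_iff] using hq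
end
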